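/- arXiv:math/0509339 — 3 statements merged into one kernel-verified Lean document; each statement's English description precedes it below -/
import Mathlib

section
/- Let G be a finite connected simple graph with n vertices and diameter d. Then π(G) ≤ (n−1)(2^d − 1) + 1. -/
open SimpleGraph Finset

variable {V : Type*}

open Classical in
/-- A single pebbling step: remove two pebbles from `u` and add one pebble on a
neighbor `v` of `u`. -/
noncomputable def PebStep (G : SimpleGraph V) (C C' : V → ℕ) : Prop :=
  ∃ u v : V, G.Adj u v ∧ 2 ≤ C u ∧
    C' = Function.update (Function.update C u (C u - 2)) v (C v + 1)

/-- The configuration `C` reaches the root `r` if some finite sequence of pebbling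
steps starting from `C` produces a configuration with a pebble on `r`. -/
def Reaches (G : SimpleGraph V) (C : V → ℕ) (r : V) : Prop :=
  ∃ C', Relation.ReflTransGen (PebStep G) C C' ∧ 1 ≤ C' r

/-- The pebbling number of `G`: the least `m` such that every configuration of size `m`
reaches every root vertex. -/
noncomputable def pebblingNumber (G : SimpleGraph V) [Fintype V] : ℕ :=
  sInf {m : ℕ | ∀ (r : V) (C : V → ℕ), ∑ v, C v = m → Reaches G C r}

/-- Along an edge from `u` to `v`, `2 * m` pebbles on `u` yield `m` further pebbles on `v`. -/
theorem exists_reflTransGen_pebStep_of_adj {G : SimpleGraph V} {u v : V} (h : G.Adj u v)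
    (m : ℕ) (C : V → ℕ) (hC : 2 * m ≤ C u) :
    ∃ C', Relation.ReflTransGen (PebStep G) C C' ∧ C v + m ≤ C' v := by
  classical
  induction m generalizing C with
  | zero => exact ⟨C, .refl, le_rfl⟩
  | succ m ih =>
    let D := Function.update (Function.update C u (C u - 2)) v (C v + 1)
    have hDu : D u = C u - 2 := by simp [D, h.ne]
    have hDv : D v = C v + 1 := by simp [D]
    obtain ⟨C', hstep, hle⟩ := ih D (by omega)
    exact ⟨C', .head ⟨u, v, h, by omega, rfl⟩ hstep, by omega⟩

/-- A vertex carrying `2 ^ k` pebbles can send a pebble along any walk of length `k`. -/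
theorem SimpleGraph.Walk.reaches {G : SimpleGraph V} {u r : V} (p : G.Walk u r)
    (C : V → ℕ) (hC : 2 ^ p.length ≤ C u) : Reaches G C r := by
  induction p generalizing C with
  | nil => exact ⟨C, .refl, by simpa using hC⟩
  | cons h p ih =>
    obtain ⟨D, hCD, hD⟩ := exists_reflTransGen_pebStep_of_adj h (2 ^ p.length) C
      (by simpa [pow_succ'] using hC)
    obtain ⟨C', hDC', hr⟩ := ih D (by omega)
    exact ⟨C', hCD.trans hDC', hr⟩

/-- For a finite connected simple graph with `n` vertices and
diameter `d`, `π(G) ≤ (n − 1)(2 ^ d − 1) + 1`. -/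
theorem pebblingNumber_le_pigeonhole [Fintype V] (G : SimpleGraph V) (hG : G.Connected) :
    pebblingNumber G ≤ (Fintype.card V - 1) * (2 ^ G.diam - 1) + 1 := by
  classical
  refine Nat.sInf_le fun r C hsum => ?_
  by_cases hr : 1 ≤ C r
  · exact ⟨C, .refl, hr⟩
  obtain ⟨v, hv⟩ : ∃ v, 2 ^ G.diam ≤ C v := by
    by_contra! hlt
    have hle : ∑ v ∈ univ.erase r, C v ≤ #(univ.erase r) • (2 ^ G.diam - 1) :=
      sum_le_card_nsmul _ _ _ fun v _ => Nat.le_sub_one_of_lt (hlt v)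
    rw [card_erase_of_mem (mem_univ r), card_univ, smul_eq_mul] at hle
    have := sum_erase_add univ C (mem_univ r)
    omega
  obtain ⟨p, hp⟩ := hG.exists_walk_length_eq_dist v r
  have := hG.nonempty
  refine p.reaches C (le_trans (Nat.pow_le_pow_right two_pos ?_) hv)
  rw [hp]
  exact dist_le_diam (connected_iff_ediam_ne_top.mp hG)
end

section
/- (Chan–Godbole) Let G be a finite connected simple graph with n vertices, diameter d ≥ 1, and domination number dom(G) (the minimum size of a set S of vertices such that every vertex of G is in S or adjacent to a vertex of S). Then π(G) ≤ 2^{d−1}(n + 2·dom(G)) − dom(G) + 1. -/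
open SimpleGraph Finset

variable {V : Type*}

/-- The domination number of `G`: the least size of a set `S` of vertices such that
every vertex is in `S` or adjacent to a vertex of `S`. -/
noncomputable def dominationNumber (G : SimpleGraph V) [Fintype V] : ℕ :=
  sInf {k : ℕ | ∃ S : Finset V, S.card = k ∧ ∀ v : V, v ∈ S ∨ ∃ u ∈ S, G.Adj u v}

/-- Moving `k` pebbles from `u` to a neighbor `v` by `k` pebbling steps. -/
theorem exists_reflTransGen_pebStep_move {G : SimpleGraph V} {u v : V} (h : G.Adj u v) (k : ℕ)
    (C : V → ℕ) (hk : 2 * k ≤ C u) :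
    ∃ C', Relation.ReflTransGen (PebStep G) C C' ∧ C' v = C v + k ∧
      ∀ w, w ≠ u → w ≠ v → C' w = C w := by
  classical
  induction k generalizing C with
  | zero => exact ⟨C, .refl, rfl, fun _ _ _ => rfl⟩
  | succ k ih =>
    have hne : u ≠ v := h.ne
    set D : V → ℕ := Function.update (Function.update C u (C u - 2)) v (C v + 1) with hD
    have hstep : PebStep G C D := ⟨u, v, h, by omega, by rw [hD]⟩
    have hDu : D u = C u - 2 := by simp [hD, hne]
    have hDv : D v = C v + 1 := by simp [hD]
    obtain ⟨C', hC', hv, hw⟩ := ih D (by omega)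
    refine ⟨C', .head hstep hC', by omega, fun w hwu hwv => ?_⟩
    rw [hw w hwu hwv]
    simp [hD, hwu, hwv]

/-- Half of the pebbles on each neighbor of `s` in `T` can be gathered on `s`. -/
theorem exists_reflTransGen_pebStep_gather {G : SimpleGraph V} {s : V} (T : Finset V)
    (hT : ∀ v ∈ T, G.Adj v s) (C : V → ℕ) :
    ∃ C', Relation.ReflTransGen (PebStep G) C C' ∧ C' s = C s + ∑ v ∈ T, C v / 2 ∧
      ∀ w, w ∉ T → w ≠ s → C' w = C w := by
  classical
  induction T using Finset.induction_on with
  | empty => exact ⟨C, .refl, by simp, fun _ _ _ => rfl⟩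
  | insert a T ha ih =>
    obtain ⟨D, hD, hDs, hDw⟩ := ih fun v hv => hT v (mem_insert_of_mem hv)
    have has : G.Adj a s := hT a (mem_insert_self a T)
    have hDa : D a = C a := hDw a ha has.ne
    obtain ⟨C', hC', hs, hw⟩ := exists_reflTransGen_pebStep_move has (C a / 2) D (by omega)
    refine ⟨C', hD.trans hC', by rw [hs, hDs, sum_insert ha]; omega, fun w hwT hws => ?_⟩
    rw [mem_insert, not_or] at hwT
    rw [hw w hwT.1 hws, hDw w hwT.2 hws]

theorem Reaches.of_reflTransGen {G : SimpleGraph V} {C D : V → ℕ} {r : V}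
    (h : Relation.ReflTransGen (PebStep G) C D) (hD : Reaches G D r) : Reaches G C r := by
  obtain ⟨E, hE, hr⟩ := hD
  exact ⟨E, h.trans hE, hr⟩

theorem Reaches.of_walk {G : SimpleGraph V} {u r : V} (p : G.Walk u r) (C : V → ℕ)
    (h : 2 ^ p.length ≤ C u) : Reaches G C r := by
  induction p generalizing C with
  | nil => exact ⟨C, .refl, by simpa using h⟩
  | cons hadj p ih =>
    rw [Walk.length_cons, pow_succ'] at h
    obtain ⟨D, hD, hv, -⟩ := exists_reflTransGen_pebStep_move hadj _ C h
    exact .of_reflTransGen hD (ih D (by omega))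

/-- A vertex carrying `2 ^ diam` pebbles reaches every root. -/
theorem Reaches.of_two_pow_diam_le {G : SimpleGraph V} (hG : G.Connected) (hd : G.ediam ≠ ⊤)
    {u : V} (r : V) {C : V → ℕ} (h : 2 ^ G.diam ≤ C u) : Reaches G C r := by
  obtain ⟨p, hp⟩ := hG.exists_walk_length_eq_dist u r
  refine .of_walk p C (le_trans ?_ h)
  rw [hp]
  exact Nat.pow_le_pow_right two_pos (dist_le_diam hd)

theorem exists_card_eq_dominationNumber (G : SimpleGraph V) [Fintype V] :
    ∃ S : Finset V, S.card = dominationNumber G ∧ ∀ v : V, v ∈ S ∨ ∃ u ∈ S, G.Adj u v :=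
  Nat.sInf_mem (s := {k : ℕ | ∃ S : Finset V, S.card = k ∧ ∀ v : V, v ∈ S ∨ ∃ u ∈ S, G.Adj u v})
    ⟨_, univ, rfl, fun v => .inl (mem_univ v)⟩

theorem dominationNumber_le_card {G : SimpleGraph V} [Fintype V] {S : Finset V}
    (hS : ∀ v : V, v ∈ S ∨ ∃ u ∈ S, G.Adj u v) : dominationNumber G ≤ S.card :=
  Nat.sInf_le ⟨S, rfl, hS⟩

/-- Ore's bound: without isolated vertices, the domination number is at most half the number
of vertices. -/
theorem two_mul_dominationNumber_le_card {G : SimpleGraph V} [Fintype V]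
    (h : ∀ v, ∃ w, G.Adj v w) : 2 * dominationNumber G ≤ Fintype.card V := by
  classical
  obtain ⟨S, hcard, hS⟩ := exists_card_eq_dominationNumber G
  have hcompl : ∀ v : V, v ∈ Sᶜ ∨ ∃ u ∈ Sᶜ, G.Adj u v := by
    intro v
    by_contra! hv
    obtain ⟨hvS, hnb⟩ := hv
    rw [mem_compl, not_not] at hvS
    have hnbS : ∀ w, G.Adj v w → w ∈ S.erase v := fun w hw =>
      mem_erase.2 ⟨hw.ne', by_contra fun hwS => hnb w (mem_compl.2 hwS) hw.symm⟩
    have hdom : ∀ x : V, x ∈ S.erase v ∨ ∃ u ∈ S.erase v, G.Adj u x := by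
      intro x
      by_cases hxv : x = v
      · obtain ⟨w, hw⟩ := h v
        exact .inr ⟨w, hnbS w hw, hxv ▸ hw.symm⟩
      · rcases hS x with hx | ⟨u, hu, hux⟩
        · exact .inl (mem_erase.2 ⟨hxv, hx⟩)
        · by_cases huv : u = v
          · exact .inl (hnbS x (huv ▸ hux))
          · exact .inr ⟨u, mem_erase.2 ⟨huv, hu⟩, hux⟩
    have h1 := dominationNumber_le_card hdom
    have h2 := card_erase_lt_of_mem hvS
    omega
  have h1 := dominationNumber_le_card hcompl
  have h2 := S.card_add_card_compl
  omega

/-- If fewer than `2 ^ diam` pebbles can be gathered on each vertex of a dominating set, then the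
configuration is small. -/
theorem sum_add_le_of_not_reaches [Fintype V] {G : SimpleGraph V} (hG : G.Connected)
    (hd : G.ediam ≠ ⊤) {S : Finset V} (hS : ∀ v : V, v ∈ S ∨ ∃ u ∈ S, G.Adj u v)
    {r : V} {C : V → ℕ} (hr : ¬ Reaches G C r) :
    ∑ v, C v + 3 * S.card ≤ S.card * (2 * 2 ^ G.diam) + Fintype.card V := by
  classical
  have hex : ∀ v, ∃ u, v ∉ S → u ∈ S ∧ G.Adj u v := fun v => by
    rcases hS v with hv | ⟨u, hu, huv⟩
    · exact ⟨v, fun h => absurd hv h⟩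
    · exact ⟨u, fun _ => ⟨hu, huv⟩⟩
  choose f hf using hex
  have hmaps : ∀ v ∈ Sᶜ, f v ∈ S := fun v hv => (hf v (mem_compl.1 hv)).1
  have hlt : ∀ s ∈ S, C s + ∑ v ∈ Sᶜ with f v = s, C v / 2 + 1 ≤ 2 ^ G.diam := by
    intro s _
    by_contra! hs
    obtain ⟨D, hD, hDs, -⟩ := exists_reflTransGen_pebStep_gather (G := G) (s := s)
      {v ∈ Sᶜ | f v = s} (fun v hv => by
        obtain ⟨hvS, hvs⟩ := mem_filter.1 hv
        exact hvs ▸ (hf v (mem_compl.1 hvS)).2.symm) C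
    exact hr (.of_reflTransGen hD (.of_two_pow_diam_le hG hd r (u := s) (by omega)))
  have hsum := sum_le_sum hlt
  rw [sum_add_distrib, sum_add_distrib, sum_fiberwise_of_maps_to hmaps] at hsum
  simp only [sum_const, smul_eq_mul, mul_one] at hsum
  have hhalf : ∑ v ∈ Sᶜ, C v ≤ 2 * ∑ v ∈ Sᶜ, C v / 2 + Sᶜ.card := by
    rw [mul_sum, card_eq_sum_ones, ← sum_add_distrib]
    exact sum_le_sum fun v _ => by omega
  have htotal := sum_add_sum_compl S C
  have hcard := S.card_add_card_compl
  have hnonneg := Nat.zero_le (∑ v ∈ S, C v)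
  linarith

/-- Chan–Godbole: For a finite connected simple graph with `n` vertices,
diameter `d ≥ 1` and domination number `dom(G)`,
`π(G) ≤ 2^{d−1}(n + 2·dom(G)) − dom(G) + 1`. -/
theorem pebblingNumber_le_domination [Fintype V] (G : SimpleGraph V) (hG : G.Connected)
    (hd : 1 ≤ G.diam) :
    pebblingNumber G ≤
      2 ^ (G.diam - 1) * (Fintype.card V + 2 * dominationNumber G) - dominationNumber G + 1 := by
  have hd0 : G.diam ≠ 0 := by omega
  have hd' : G.ediam ≠ ⊤ := ediam_ne_top_of_diam_ne_zero hd0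
  have : Nontrivial V := nontrivial_of_diam_ne_zero hd0
  refine Nat.sInf_le fun r C hC => by_contra fun hr => ?_
  obtain ⟨S, hcard, hS⟩ := exists_card_eq_dominationNumber G
  have hbound := sum_add_le_of_not_reaches hG hd' hS hr
  have hore : 2 * dominationNumber G ≤ Fintype.card V :=
    two_mul_dominationNumber_le_card hG.preconnected.exists_adj_of_nontrivial
  obtain ⟨e, he⟩ : ∃ e, G.diam = e + 1 := ⟨G.diam - 1, by omega⟩
  rw [hC, hcard, he, Nat.add_sub_cancel, pow_succ] at hbound
  obtain ⟨q, hq⟩ : ∃ q, 2 ^ e = q + 1 := ⟨2 ^ e - 1, by have := Nat.one_le_two_pow (n := e); omega⟩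
  rw [hq] at hbound
  have hmul := Nat.mul_le_mul_left q hore
  have hle : dominationNumber G ≤ (q + 1) * (Fintype.card V + 2 * dominationNumber G) := by
    nlinarith
  zify [hle] at hbound hmul
  nlinarith
end

section
/- (Clarke–Hochberg–Hurlbert) Let G be a finite connected simple graph with diameter 2 and vertex connectivity κ(G) ≥ 3. Then G is Class 0, i.e. π(G) = n(G). -/
open SimpleGraph Finset

variable {V : Type*}

/-- The vertex connectivity of `G`: the least size of a set `S` of vertices whose
removal disconnects `G` or leaves at most one vertex. -/
noncomputable def vertexConnectivity (G : SimpleGraph V) [Fintype V] : ℕ :=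
  sInf {k : ℕ | ∃ S : Finset V,
    S.card = k ∧ (¬ (G.induce ((↑S : Set V)ᶜ)).Connected ∨ ∀ v w : V, v ∉ S → w ∉ S → v = w)}

theorem exists_pebStep {G : SimpleGraph V} {C : V → ℕ} {u v : V} (h : G.Adj u v)
    (hu : 2 ≤ C u) :
    ∃ C', PebStep G C C' ∧ C' u = C u - 2 ∧ C' v = C v + 1 ∧
      ∀ x, x ≠ u → x ≠ v → C' x = C x := by
  classical
  refine ⟨_, ⟨u, v, h, hu, rfl⟩, ?_, ?_, ?_⟩
  · simp [Function.update_of_ne h.ne]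
  · simp
  · intro x hxu hxv
    simp [Function.update_of_ne hxu, Function.update_of_ne hxv]

namespace Reaches

variable {G : SimpleGraph V} {C C' : V → ℕ} {r u v w x : V}

theorem of_pos (h : 1 ≤ C r) : Reaches G C r := ⟨C, .refl, h⟩

theorem trans_reflTransGen (h : Relation.ReflTransGen (PebStep G) C C')
    (h' : Reaches G C' r) : Reaches G C r := by
  obtain ⟨D, hD, hr⟩ := h'
  exact ⟨D, h.trans hD, hr⟩

theorem head (h : PebStep G C C') (h' : Reaches G C' r) : Reaches G C r :=
  trans_reflTransGen (.single h) h'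

theorem of_adj (h : G.Adj u r) (hu : 2 ≤ C u) : Reaches G C r := by
  obtain ⟨C', hs, -, hr, -⟩ := exists_pebStep h hu
  exact head hs (of_pos (by omega))

theorem of_adj_pebbled (h : G.Adj u x) (hx : G.Adj x r) (hu : 2 ≤ C u) (hCx : 1 ≤ C x) :
    Reaches G C r := by
  obtain ⟨C', hs, -, h', -⟩ := exists_pebStep h hu
  exact head hs (of_adj hx (by omega))

theorem of_four (h : G.Adj u x) (hx : G.Adj x r) (hu : 4 ≤ C u) : Reaches G C r := by
  obtain ⟨C', hs, h₁, h₂, -⟩ := exists_pebStep h (by omega : 2 ≤ C u)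
  exact head hs (of_adj_pebbled h hx (by omega) (by omega))

theorem of_two_twos (huv : u ≠ v) (h : G.Adj u x) (h' : G.Adj v x) (hx : G.Adj x r)
    (hu : 2 ≤ C u) (hv : 2 ≤ C v) : Reaches G C r := by
  obtain ⟨C', hs, -, h₂, h₃⟩ := exists_pebStep h hu
  have := h₃ v huv.symm h'.ne
  exact head hs (of_adj_pebbled h' hx (by omega) (by omega))

theorem of_adj_three (h : G.Adj v u) (hux : G.Adj u x) (hx : G.Adj x r)
    (hv : 2 ≤ C v) (hu : 3 ≤ C u) : Reaches G C r := by
  obtain ⟨C', hs, -, h₂, -⟩ := exists_pebStep h hv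
  exact head hs (of_four hux hx (by omega))

theorem of_common_pebbled (hne : v ≠ u) (hvw : G.Adj v w) (hwu : G.Adj w u)
    (hux : G.Adj u x) (hx : G.Adj x r) (hv : 2 ≤ C v) (hw : 1 ≤ C w) (hu : 3 ≤ C u) :
    Reaches G C r := by
  obtain ⟨C', hs, -, h₂, h₃⟩ := exists_pebStep hvw hv
  have := h₃ u hne.symm hwu.ne.symm
  exact head hs (of_adj_three hwu hux hx (by omega) (by omega))

theorem of_common_three {v' : V} (hvv : v ≠ v') (hne : v ≠ u) (hne' : v' ≠ u)
    (hvw : G.Adj v w) (hvw' : G.Adj v' w) (hwu : G.Adj w u)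
    (hux : G.Adj u x) (hx : G.Adj x r) (hv : 2 ≤ C v) (hv' : 2 ≤ C v') (hu : 3 ≤ C u) :
    Reaches G C r := by
  obtain ⟨C', hs, -, h₂, h₃⟩ := exists_pebStep hvw hv
  have h₄ := h₃ u hne.symm hwu.ne.symm
  have h₅ := h₃ v' hvv.symm hvw'.ne
  exact head hs (of_common_pebbled hne' hvw' hwu hux hx (by omega) (by omega) (by omega))

end Reaches

/-- A pebble can be carried along a path whose inner vertices are all pebbled. -/
theorem exists_reflTransGen_of_isPath {G : SimpleGraph V} {u v : V} (p : G.Walk u v) :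
    ∀ (C : V → ℕ), p.IsPath → u ≠ v → 2 ≤ C u →
      (∀ x ∈ p.support, x ≠ u → x ≠ v → 1 ≤ C x) →
      ∃ C', Relation.ReflTransGen (PebStep G) C C' ∧ C v + 1 ≤ C' v ∧
        ∀ x, x ∉ p.support → C' x = C x := by
  induction p with
  | nil => intro C _ h; exact absurd rfl h
  | @cons a b c h p ih =>
    intro C hp hac ha hin
    rw [Walk.cons_isPath_iff] at hp
    obtain ⟨C₁, hs, -, h₂, h₃⟩ := exists_pebStep h ha
    by_cases hbc : b = c
    · subst hbc
      refine ⟨C₁, .single hs, h₂.ge, fun x hx => ?_⟩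
      simp only [Walk.support_cons, List.mem_cons, not_or] at hx
      exact h₃ x hx.1 (fun hxb => hx.2 (hxb ▸ p.start_mem_support))
    · have hb := hin b (by simp) h.ne.symm hbc
      obtain ⟨C', hC', hc, hoff⟩ := ih C₁ hp.1 hbc (by omega) (fun x hx hxb hxc => by
        have hxa : x ≠ a := fun e => hp.2 (e ▸ hx)
        rw [h₃ x hxa hxb]
        exact hin x (by simp [hx]) hxa hxc)
      refine ⟨C', (Relation.ReflTransGen.single hs).trans hC', ?_, fun x hx => ?_⟩
      · rwa [h₃ c (Ne.symm hac) (Ne.symm hbc)] at hc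
      · simp only [Walk.support_cons, List.mem_cons, not_or] at hx
        rw [hoff x hx.2, h₃ x hx.1 (fun hxb => hx.2 (hxb ▸ p.start_mem_support))]

theorem adj_or_exists_common_of_diam_two [Fintype V] {G : SimpleGraph V} (hG : G.Connected)
    (hd : G.diam = 2) {u v : V} (huv : u ≠ v) :
    G.Adj u v ∨ ∃ w, G.Adj u w ∧ G.Adj w v := by
  have hle : G.dist u v ≤ 2 := by
    rw [← hd]
    exact dist_le_diam (fun h => by simp [diam, h] at hd)
  obtain ⟨p, hp⟩ := hG.exists_walk_length_eq_dist u v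
  rw [← hp] at hle
  match p, hle with
  | .nil, _ => exact absurd rfl huv
  | .cons h .nil, _ => exact .inl h
  | .cons h (.cons h' .nil), _ => exact .inr ⟨_, h, h'⟩
  | .cons _ (.cons _ (.cons _ _)), h => simp at h

/-- Deleting fewer vertices than the vertex connectivity leaves a path between any two
remaining vertices. -/
theorem exists_isPath_avoiding [Fintype V] {G : SimpleGraph V} {S : Finset V}
    (hS : S.card < vertexConnectivity G) {u v : V} (hu : u ∉ S) (hv : v ∉ S) :
    ∃ p : G.Walk u v, p.IsPath ∧ ∀ x ∈ p.support, x ∉ S := by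
  classical
  have hconn : (G.induce ((↑S : Set V)ᶜ)).Connected := by
    by_contra h
    exact hS.not_ge (Nat.sInf_le ⟨S, rfl, .inl h⟩)
  obtain ⟨p, hp⟩ := (hconn.preconnected (⟨u, by simpa using hu⟩ : ((↑S : Set V)ᶜ : Set V))
    ⟨v, by simpa using hv⟩).exists_isPath
  let f : G.induce ((↑S : Set V)ᶜ) →g G := (Embedding.induce _).toHom
  have hf : Function.Injective f := Subtype.val_injective
  have hav : ∀ x ∈ (p.map f).support, x ∉ S := by
    intro x hx
    rw [Walk.support_map, List.mem_map] at hx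
    obtain ⟨y, -, rfl⟩ := hx
    exact fun h => y.2 (mem_coe.2 h)
  exact ⟨p.map f, hp.map hf, hav⟩

/-- No configuration with fewer pebbles than vertices reaches every root. -/
theorem card_le_of_forall_reaches [Fintype V] [Nonempty V] {G : SimpleGraph V} {m : ℕ}
    (hm : ∀ (r : V) (C : V → ℕ), ∑ v, C v = m → Reaches G C r) : Fintype.card V ≤ m := by
  classical
  by_contra! hlt
  obtain ⟨r⟩ := ‹Nonempty V›
  obtain ⟨s, hs, hcard⟩ := Finset.exists_subset_card_eq (s := univ.erase r) (n := m)
    (by rw [card_erase_of_mem (mem_univ r), card_univ]; omega)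
  obtain ⟨C', hC', hr⟩ := hm r (fun v => if v ∈ s then 1 else 0) (by simp [hcard])
  rcases hC'.cases_head with rfl | ⟨D, ⟨u, v, -, h, -⟩, -⟩
  · have : r ∉ s := fun h => by simpa using hs h
    simp [this] at hr
  · dsimp only at h
    split_ifs at h <;> omega

/-- In a configuration with as many pebbles as vertices, empty vertices compensate for the
excess on vertices with two or three pebbles. -/
theorem card_zero_eq_of_sum_eq_card [Fintype V] [DecidableEq V] {C : V → ℕ}
    (hsum : ∑ v, C v = Fintype.card V) (hle : ∀ v, C v ≤ 3) :
    #{v | C v = 0} = #{v | 2 ≤ C v} + #{v | C v = 3} := by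
  have key : ∑ v, (C v + if C v = 0 then 1 else 0) =
      ∑ v, (1 + (if 2 ≤ C v then 1 else 0) + if C v = 3 then 1 else 0) :=
    sum_congr rfl fun v _ => by
      have := hle v
      interval_cases C v <;> simp
  simp only [sum_add_distrib, ← card_filter, sum_const, card_univ, smul_eq_mul, mul_one] at key
  omega

/-- In a graph of diameter two, a configuration with as many pebbles as vertices that does not
reach `r` has a vertex `p` with three pebbles, and its empty vertices are accounted for by `r`,
a common neighbor of `r` with each heavy vertex, and a common neighbor of `p` with each other
heavy vertex; moreover every heavy vertex has exactly three pebbles. -/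
theorem exists_structure_of_not_reaches [Fintype V] {G : SimpleGraph V} (hG : G.Connected)
    (hd : G.diam = 2) {r : V} {C : V → ℕ} (hsum : ∑ v, C v = Fintype.card V)
    (hnot : ¬ Reaches G C r) :
    ∃ (p : V) (c w : V → V), C p = 3 ∧ (∀ u, 2 ≤ C u → C u = 3) ∧
      (∀ u, 2 ≤ C u → G.Adj u (c u) ∧ G.Adj (c u) r) ∧
      (∀ u, 2 ≤ C u → u ≠ p → G.Adj u (w u) ∧ G.Adj (w u) p) ∧
      ∀ z, C z = 0 → z = r ∨ (∃ u, 2 ≤ C u ∧ z = c u) ∨ ∃ u, 2 ≤ C u ∧ u ≠ p ∧ z = w u := by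
  classical
  have hr0 : C r = 0 := by
    by_contra h
    exact hnot (.of_pos (by omega))
  have hnr : ∀ u, 2 ≤ C u → ¬ G.Adj u r := fun u hu h => hnot (.of_adj h hu)
  have hex : ∀ u, 2 ≤ C u → ∃ x, G.Adj u x ∧ G.Adj x r := fun u hu =>
    (adj_or_exists_common_of_diam_two hG hd (by rintro rfl; omega)).resolve_left (hnr u hu)
  have hle : ∀ v, C v ≤ 3 := by
    intro v
    by_contra! h
    obtain ⟨x, h₁, h₂⟩ := hex v (by omega)
    exact hnot (.of_four h₁ h₂ (by omega))
  choose! c hc using hex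
  have hc0 : ∀ u, 2 ≤ C u → C (c u) = 0 := fun u hu => by
    by_contra h
    exact hnot (.of_adj_pebbled (hc u hu).1 (hc u hu).2 hu (by omega))
  have hcount := card_zero_eq_of_sum_eq_card hsum hle
  set B : Finset V := {v | 2 ≤ C v} with hB
  set Z : Finset V := {v | C v = 0} with hZ
  have memB : ∀ v, v ∈ B ↔ 2 ≤ C v := by simp [hB]
  have hcinj : Set.InjOn c B := by
    intro u hu v hv huv
    rw [mem_coe, memB] at hu hv
    by_contra hne
    exact hnot (.of_two_twos hne (hc u hu).1 (huv ▸ (hc v hv).1) (hc u hu).2 hu hv)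
  have hsub₁ : insert r (B.image c) ⊆ Z := by
    intro z hz
    rcases mem_insert.1 hz with rfl | hz
    · simpa [hZ] using hr0
    · obtain ⟨u, hu, rfl⟩ := mem_image.1 hz
      simpa [hZ] using hc0 u ((memB u).1 hu)
  have hrc : r ∉ B.image c := by
    intro h
    obtain ⟨u, hu, h⟩ := mem_image.1 h
    exact (hc u ((memB u).1 hu)).2.ne h
  have hcard₁ : #(insert r (B.image c)) = #B + 1 := by
    rw [card_insert_of_notMem hrc, card_image_of_injOn hcinj]
  obtain ⟨p, hp⟩ : ∃ p, C p = 3 := by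
    have := card_le_card hsub₁
    obtain ⟨p, hp⟩ := card_pos.1 (show 0 < #{v | C v = 3} by omega)
    exact ⟨p, by simpa using hp⟩
  have hp2 : 2 ≤ C p := by omega
  have hex' : ∀ u, 2 ≤ C u → u ≠ p → ∃ x, G.Adj u x ∧ G.Adj x p := fun u hu hup =>
    (adj_or_exists_common_of_diam_two hG hd hup).resolve_left fun h =>
      hnot (.of_adj_three h (hc p hp2).1 (hc p hp2).2 hu hp.ge)
  choose! w hw using hex'
  have hw0 : ∀ u, 2 ≤ C u → u ≠ p → C (w u) = 0 := fun u hu hup => by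
    by_contra h
    exact hnot (.of_common_pebbled hup (hw u hu hup).1 (hw u hu hup).2 (hc p hp2).1
      (hc p hp2).2 hu (by omega) hp.ge)
  have hwinj : Set.InjOn w (B.erase p) := by
    intro u hu v hv huv
    rw [mem_coe, mem_erase, memB] at hu hv
    by_contra hne
    exact hnot (.of_common_three hne hu.1 hv.1 (hw u hu.2 hu.1).1 (huv ▸ (hw v hv.2 hv.1).1)
      (hw u hu.2 hu.1).2 (hc p hp2).1 (hc p hp2).2 hu.2 hv.2 hp.ge)
  have hdisj : Disjoint (insert r (B.image c)) ((B.erase p).image w) := by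
    rw [disjoint_right]
    intro z hz hz'
    obtain ⟨u, hu, rfl⟩ := mem_image.1 hz
    rw [mem_erase, memB] at hu
    rcases mem_insert.1 hz' with h | h
    · exact hnr u hu.2 (h ▸ (hw u hu.2 hu.1).1)
    · obtain ⟨v, hv, h⟩ := mem_image.1 h
      have h' := (hc v ((memB v).1 hv)).2
      rw [h] at h'
      exact hnot (.of_two_twos hu.1 (hw u hu.2 hu.1).1 (hw u hu.2 hu.1).2.symm h' hu.2 hp2)
  have hsub : insert r (B.image c) ∪ (B.erase p).image w ⊆ Z := by
    refine union_subset hsub₁ fun z hz => ?_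
    obtain ⟨u, hu, rfl⟩ := mem_image.1 hz
    rw [mem_erase, memB] at hu
    simpa [hZ] using hw0 u hu.2 hu.1
  have hcard : #(insert r (B.image c) ∪ (B.erase p).image w) = 2 * #B := by
    have hpos : 0 < #B := card_pos.2 ⟨p, (memB p).2 hp2⟩
    rw [card_union_of_disjoint hdisj, hcard₁, card_image_of_injOn hwinj,
      card_erase_of_mem ((memB p).2 hp2)]
    omega
  have hsub₃ : ({v | C v = 3} : Finset V) ⊆ B := fun v hv => by
    rw [memB]
    have : C v = 3 := by simpa using hv
    omega
  have hZle := card_le_card hsub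
  have h3le := card_le_card hsub₃
  have hB3 := eq_of_subset_of_card_le hsub₃ (by omega)
  have hZeq := eq_of_subset_of_card_le hsub (by omega)
  refine ⟨p, c, w, hp, fun u hu => ?_, hc, hw, fun z hz => ?_⟩
  · have := (memB u).2 hu
    rw [← hB3] at this
    simpa using this
  · have hz' : z ∈ Z := by simpa [hZ] using hz
    rw [← hZeq, mem_union, mem_insert, mem_image, mem_image] at hz'
    rcases hz' with (h | ⟨u, hu, h⟩) | ⟨u, hu, h⟩
    · exact .inl h
    · exact .inr (.inl ⟨u, (memB u).1 hu, h.symm⟩)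
    · rw [mem_erase, memB] at hu
      exact .inr (.inr ⟨u, hu.2, hu.1, h.symm⟩)

theorem reaches_of_diam_two_of_sum_eq_card [Fintype V] {G : SimpleGraph V} (hG : G.Connected)
    (hd : G.diam = 2) (hk : 3 ≤ vertexConnectivity G) (r : V) (C : V → ℕ)
    (hsum : ∑ v, C v = Fintype.card V) : Reaches G C r := by
  classical
  by_contra hnot
  obtain ⟨p, c, w, hp, h3, hc, hw, hz⟩ := exists_structure_of_not_reaches hG hd hsum hnot
  have hr0 : C r = 0 := by
    by_contra h
    exact hnot (.of_pos (by omega))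
  have hp2 : 2 ≤ C p := by omega
  have hpr : p ≠ r := by rintro rfl; omega
  obtain ⟨hpc, hcr⟩ := hc p hp2
  -- A path from `p` to `r` must meet an empty vertex other than `r`.
  have hpath : ∀ q : G.Walk p r, q.IsPath → ∃ x ∈ q.support, x ≠ r ∧ C x = 0 := by
    intro q hq
    by_contra! h
    obtain ⟨C', hC', hr, -⟩ := exists_reflTransGen_of_isPath q C hq hpr hp2
      (fun x hx _ hxr => Nat.one_le_iff_ne_zero.2 (h x hx hxr))
    exact hnot (.trans_reflTransGen hC' (.of_pos (by omega)))
  by_cases hone : ∀ u, 2 ≤ C u → u = p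
  · obtain ⟨q, hq, hav⟩ := exists_isPath_avoiding (G := G) (S := {c p})
      (by rw [card_singleton]; omega)
      (by simpa using hpc.ne) (by simpa using hcr.ne.symm)
    obtain ⟨x, hx, hxr, hx0⟩ := hpath q hq
    rcases hz x hx0 with h | ⟨u, hu, h⟩ | ⟨u, hu, hup, h⟩
    · exact hxr h
    · exact hav x hx (by simp [h, hone u hu])
    · exact hup (hone u hu)
  push Not at hone
  obtain ⟨s, hs, hsp⟩ := hone
  have hs3 := h3 s hs
  obtain ⟨hsc, hscr⟩ := hc s hs
  have htwo : ∀ u, 2 ≤ C u → u ≠ p → u = s := by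
    intro u hu hup
    by_contra hus
    rcases adj_or_exists_common_of_diam_two hG hd hus with h | ⟨y, huy, hys⟩
    · exact hnot (.of_adj_three h hsc hscr hu hs3.ge)
    have hy0 : C y = 0 := by
      by_contra h
      exact hnot (.of_common_pebbled hus huy hys hsc hscr hu (by omega) hs3.ge)
    rcases hz y hy0 with rfl | ⟨v, hv, rfl⟩ | ⟨v, hv, hvp, rfl⟩
    · exact hnot (.of_adj huy hu)
    · exact hnot (.of_two_twos hus huy hys.symm (hc v hv).2 hu hs)
    · exact hnot (.of_common_three hus hup hsp huy hys.symm (hw v hv hvp).2 hpc hcr hu hs hp.ge)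
  obtain ⟨hsw, hwp⟩ := hw s hs hsp
  obtain ⟨q, hq, hav⟩ := exists_isPath_avoiding (G := G) (S := {c p, w s}) (u := p) (v := r)
    (lt_of_le_of_lt card_le_two (by omega))
    (by simpa using ⟨hpc.ne, hwp.ne.symm⟩)
    (by
      simp only [mem_insert, mem_singleton, not_or]
      exact ⟨hcr.ne.symm, fun h => hnot (.of_adj (h ▸ hsw) hs)⟩)
  have hzero : ∀ x ∈ q.support, x ≠ r → C x = 0 → x = c s := by
    intro x hx hxr hx0
    rcases hz x hx0 with h | ⟨u, hu, h⟩ | ⟨u, hu, hup, h⟩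
    · exact absurd h hxr
    · by_cases hup : u = p
      · exact absurd (by simp [h, hup]) (hav x hx)
      · rw [h, htwo u hu hup]
    · exact absurd (by simp [h, htwo u hu hup]) (hav x hx)
  obtain ⟨x, hx, hxr, hx0⟩ := hpath q hq
  obtain rfl := hzero x hx hxr hx0
  have hrq : r ∉ (q.takeUntil (c s) hx).support :=
    Walk.endpoint_notMem_support_takeUntil hq hx hxr.symm
  have hpos : ∀ y ∈ (q.takeUntil (c s) hx).support, y ≠ c s → 1 ≤ C y := by
    intro y hy hyc
    by_contra h
    exact hyc (hzero y (Walk.support_takeUntil_subset_support q hx hy)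
      (fun e => hrq (e ▸ hy)) (by omega))
  have hqt := hq.takeUntil hx
  by_cases hsq : s ∈ (q.takeUntil (c s) hx).support
  · have hcs : c s ∉ ((q.takeUntil (c s) hx).takeUntil s hsq).support :=
      Walk.endpoint_notMem_support_takeUntil hqt hsq hsc.ne.symm
    obtain ⟨C', hC', h', -⟩ := exists_reflTransGen_of_isPath _ C (hqt.takeUntil hsq) hsp.symm hp2
      (fun y hy _ _ => hpos y (Walk.support_takeUntil_subset_support _ hsq hy)
        (fun e => hcs (e ▸ hy)))
    exact hnot (.trans_reflTransGen hC' (.of_four hsc hscr (by omega)))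
  · obtain ⟨C', hC', h', hoff⟩ := exists_reflTransGen_of_isPath _ C hqt
      (by rintro rfl; omega) hp2 (fun y hy _ => hpos y hy)
    have := hoff s hsq
    exact hnot (.trans_reflTransGen hC' (.of_adj_pebbled hsc hscr (by omega) (by omega)))

/-- Clarke–Hochberg–Hurlbert: a finite connected simple graph of
diameter 2 with vertex connectivity at least 3 is Class 0, i.e. `π(G) = n(G)`. -/
theorem class0_of_diam_two_conn_three [Fintype V] (G : SimpleGraph V) (hG : G.Connected)
    (hd : G.diam = 2) (hk : 3 ≤ vertexConnectivity G) :
    pebblingNumber G = Fintype.card V := by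
  have := hG.nonempty
  have hmem : Fintype.card V ∈
      {m : ℕ | ∀ (r : V) (C : V → ℕ), ∑ v, C v = m → Reaches G C r} :=
    reaches_of_diam_two_of_sum_eq_card hG hd hk
  exact le_antisymm (Nat.sInf_le hmem) (card_le_of_forall_reaches (Nat.sInf_mem ⟨_, hmem⟩))
end
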